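/- If G is a finite simple graph with at least one edge and χ(G) = Δ(G), then vs_χ(G) = ivs_χ(G), i.e., the chromatic vertex stability number of G equals its independent chromatic vertex stability number. -/

import Mathlib

open SimpleGraph

/-- The chromatic number of a graph, as a natural number (for finite graphs this
is the usual chromatic number). -/
noncomputable def chromNum {V : Type*} (G : SimpleGraph V) : ℕ :=
  sInf {n : ℕ | G.Colorable n}

/-- The maximum degree Δ(G) of a finite graph. -/
noncomputable def maxDeg {V : Type*} [Fintype V] (G : SimpleGraph V) : ℕ :=
  Finset.univ.sup fun v => Nat.card (G.neighborSet v)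

/-- The chromatic vertex stability number: the minimum number of vertices whose
deletion results in a graph with chromatic number χ(G) − 1. -/
noncomputable def vsChi {V : Type*} [Fintype V] (G : SimpleGraph V) : ℕ :=
  sInf {k : ℕ | ∃ S : Finset V, S.card = k ∧
    chromNum (G.induce ((S : Set V))ᶜ) = chromNum G - 1}

/-- The independent chromatic vertex stability number: the minimum size of an
independent set of vertices whose deletion results in a graph with chromatic
number χ(G) − 1. -/
noncomputable def ivsChi {V : Type*} [Fintype V] (G : SimpleGraph V) : ℕ :=
  sInf {k : ℕ | ∃ S : Finset V, S.card = k ∧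
    (∀ u ∈ S, ∀ v ∈ S, ¬ G.Adj u v) ∧
    chromNum (G.induce ((S : Set V))ᶜ) = chromNum G - 1}

/-- The chromatic edge stability number: the minimum number of edges whose
deletion results in a graph with chromatic number χ(G) − 1. -/
noncomputable def esChi {V : Type*} (G : SimpleGraph V) : ℕ :=
  sInf {k : ℕ | ∃ F : Finset (Sym2 V), ↑F ⊆ G.edgeSet ∧ F.card = k ∧
    chromNum (G.deleteEdges ↑F) = chromNum G - 1}

open Finset

section Recoloring

variable {V α : Type*}

/-- A colouring is *proper off* `z` if adjacent vertices only share a colour when it is `z`. -/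
def ProperOff (G : SimpleGraph V) (z : α) (f : V → α) : Prop :=
  ∀ ⦃x y⦄, G.Adj x y → f x = f y → f x = z

theorem ProperOff.update [DecidableEq V] {G : SimpleGraph V} {z : α} {f : V → α}
    (hf : ProperOff G z f) {x : V} {i : α} (h : ∀ y, G.Adj x y → f y ≠ i) :
    ProperOff G z (Function.update f x i) := by
  intro a b hab
  rcases eq_or_ne a x with rfl | ha
  · rw [Function.update_self, Function.update_of_ne hab.ne']
    exact fun e => absurd e.symm (h b hab)
  · rcases eq_or_ne b x with rfl | hb
    · rw [Function.update_self, Function.update_of_ne ha]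
      exact fun e => absurd e (h a hab.symm)
    · rw [Function.update_of_ne ha, Function.update_of_ne hb]
      exact hf hab

theorem ProperOff.update_base [DecidableEq V] {G : SimpleGraph V} {z : α} {f : V → α}
    (hf : ProperOff G z f) (x : V) : ProperOff G z (Function.update f x z) := by
  intro a b hab
  by_cases ha : a = x
  · simp [ha]
  · by_cases hb : b = x
    · subst hb
      simp [ha]
    · rw [Function.update_of_ne ha, Function.update_of_ne hb]
      exact hf hab

variable [Fintype V] [DecidableEq V] [DecidableEq α]

/-- If `x` lies in a smallest possible `z`-class, every other colour occurs around `x`. -/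
theorem exists_adj_color_of_minimal {G : SimpleGraph V} {z : α} {f : V → α}
    (hf : ProperOff G z f)
    (hmin : ∀ f', ProperOff G z f' → #{v | f v = z} ≤ #{v | f' v = z})
    {x : V} (hx : f x = z) {i : α} (hi : i ≠ z) : ∃ y, G.Adj x y ∧ f y = i := by
  by_contra! h
  refine absurd (hmin _ (hf.update h)) (not_le.2 (card_lt_card ?_))
  rw [Finset.ssubset_iff_of_subset]
  · exact ⟨x, by simpa using hx, by simpa using hi⟩
  · intro a
    rcases eq_or_ne a x with rfl | ha
    · simp [hx]
    · simp [Function.update_of_ne ha]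

/-- If `x` is in a smallest possible `z`-class and has a neighbour there, then all neighbours of
`x` have different colours. -/
theorem injOn_neighborFinset_of_minimal [Fintype α] {G : SimpleGraph V} [DecidableRel G.Adj] {z : α}
    {f : V → α} (hf : ProperOff G z f)
    (hmin : ∀ f', ProperOff G z f' → #{v | f v = z} ≤ #{v | f' v = z})
    {x u : V} (hdeg : G.degree x ≤ Fintype.card α)
    (hx : f x = z) (hxu : G.Adj x u) (hu : f u = z) :
    Set.InjOn f (G.neighborFinset x) := by
  have himage : (G.neighborFinset x).image f = univ := by
    refine eq_univ_of_forall fun i => mem_image.2 ?_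
    by_cases hi : i = z
    · exact ⟨u, by simpa using hxu, hu.trans hi.symm⟩
    · obtain ⟨y, hy, hyi⟩ := exists_adj_color_of_minimal hf hmin hx hi
      exact ⟨y, by simpa using hy, hyi⟩
  refine card_image_iff.1 (le_antisymm card_image_le ?_)
  rwa [himage, card_univ, G.card_neighborFinset_eq_degree]

/-- If the maximum degree is at most the number of colours and a proper colouring exists, then any
colouring that is proper off `z` can be replaced by a proper one whose `z`-class is not larger. -/
theorem exists_coloring_card_fiber_le [Fintype α] (G : SimpleGraph V) [DecidableRel G.Adj] (z : α)
    (g : G.Coloring α) (hdeg : ∀ v, G.degree v ≤ Fintype.card α) {f₀ : V → α}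
    (hf₀ : ProperOff G z f₀) :
    ∃ c : G.Coloring α, #{v | c v = z} ≤ #{v | f₀ v = z} := by
  let conf (f : V → α) : Finset (V × V) := {p | G.Adj p.1 p.2 ∧ f p.1 = z ∧ f p.2 = z}
  let μ (f : V → α) : ℕ ×ₗ ℕ ×ₗ ℕ :=
    toLex (#{v | f v = z}, toLex (#(conf f), #{v | f v ≠ g v}))
  obtain ⟨f, hf, hfmin⟩ := (InvImage.wf μ wellFounded_lt).has_min
    {f | ProperOff G z f} ⟨f₀, hf₀⟩
  replace hf : ProperOff G z f := hf
  have hmin : ∀ f', ProperOff G z f' → #{v | f v = z} ≤ #{v | f' v = z} := by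
    intro f' hf'
    by_contra! hlt
    exact hfmin f' hf' (Prod.Lex.toLex_lt_toLex.2 (Or.inl hlt))
  by_cases hproper : ∀ x y, G.Adj x y → f x ≠ f y
  · exact ⟨Coloring.mk f fun {x y} h => hproper x y h, hmin f₀ hf₀⟩
  exfalso
  obtain ⟨v, u, hvu, hv, hu, hgv⟩ : ∃ v u, G.Adj v u ∧ f v = z ∧ f u = z ∧ g v ≠ z := by
    push Not at hproper
    obtain ⟨x, y, hxy, he⟩ := hproper
    have hx := hf hxy he
    by_cases hgx : g x = z
    · exact ⟨y, x, hxy.symm, he ▸ hx, hx, fun h => g.valid hxy (hgx.trans h.symm)⟩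
    · exact ⟨x, y, hxy, hx, he ▸ hx, hgx⟩
  obtain ⟨n, hvn, hn⟩ := exists_adj_color_of_minimal hf hmin hv hgv
  have hinj := injOn_neighborFinset_of_minimal hf hmin (hdeg v) hv hvu hu
  have hnv : n ≠ v := hvn.symm.ne
  -- exchange the colours of `v` and `n`
  set f' := Function.update (Function.update f n z) v (g v)
  have hf'v : f' v = g v := by simp [f']
  have hf'n : f' n = z := by simp [f', hnv]
  have hf'o : ∀ a, a ≠ v → a ≠ n → f' a = f a := fun a h₁ h₂ => by simp [f', h₁, h₂]
  have hf' : ProperOff G z f' := by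
    refine (hf.update_base n).update fun y hy => ?_
    rcases eq_or_ne y n with rfl | hyn
    · simpa using hgv.symm
    · rw [Function.update_of_ne hyn]
      exact fun h => hyn (hinj (by simpa using hy) (by simpa using hvn) (h.trans hn.symm))
  have hfiber : #{a | f' a = z} = #{a | f a = z} := by
    have h : ({a | f' a = z} : Finset V) = insert n (({a | f a = z} : Finset V).erase v) := by
      ext a
      by_cases h₁ : a = v
      · subst h₁; simp [hf'v, hgv, hnv.symm]
      · by_cases h₂ : a = n
        · subst h₂; simp [hf'n]
        · simp [hf'o a h₁ h₂, h₁, h₂]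
    rw [h, card_insert_of_notMem (by simp [hn, hgv]), card_erase_add_one (by simpa using hv)]
  have hmin' : ∀ f'', ProperOff G z f'' → #{v | f' v = z} ≤ #{v | f'' v = z} :=
    fun f'' h => hfiber ▸ hmin f'' h
  obtain ⟨w, hw⟩ : ∃ w, ∀ y, G.Adj n y → f' y = z → y = w := by
    by_cases h : ∃ w, G.Adj n w ∧ f' w = z
    · obtain ⟨w, hnw, hw⟩ := h
      exact ⟨w, fun y hy hyz => injOn_neighborFinset_of_minimal hf' hmin' (hdeg n) hf'n hnw hw
        (by simpa using hy) (by simpa using hnw) (hyz.trans hw.symm)⟩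
    · exact ⟨n, fun y hy hyz => absurd ⟨y, hy, hyz⟩ h⟩
  have hconf : #(conf f') ≤ #(conf f) := by
    have hpair : ({(v, u), (u, v)} : Finset (V × V)) ⊆ conf f := by
      intro p hp
      simp only [mem_insert, mem_singleton] at hp
      rcases hp with rfl | rfl
      · simpa [conf] using ⟨hvu, hv, hu⟩
      · simpa [conf] using ⟨hvu.symm, hu, hv⟩
    have hsub : conf f' ⊆ {(n, w), (w, n)} ∪ (conf f \ {(v, u), (u, v)}) := by
      rintro ⟨a, b⟩ hp
      obtain ⟨hab, ha, hb⟩ : G.Adj a b ∧ f' a = z ∧ f' b = z := by simpa [conf] using hp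
      have hav : a ≠ v := by rintro rfl; exact hgv (hf'v ▸ ha)
      have hbv : b ≠ v := by rintro rfl; exact hgv (hf'v ▸ hb)
      by_cases han : a = n
      · subst han
        simp [hw b hab hb]
      · by_cases hbn : b = n
        · subst hbn
          simp [hw a hab.symm ha]
        · rw [hf'o a hav han] at ha
          rw [hf'o b hbv hbn] at hb
          simp [conf, hab, ha, hb, hav, hbv]
    have h₁ := card_le_card hsub
    have h₂ := card_union_le {(n, w), (w, n)} (conf f \ {(v, u), (u, v)})
    have h₃ : #({(n, w), (w, n)} : Finset (V × V)) ≤ 2 := card_le_two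
    have h₄ : #({(v, u), (u, v)} : Finset (V × V)) = 2 :=
      card_pair fun h => hvu.ne (congrArg Prod.fst h)
    have h₅ := card_sdiff_add_card_eq_card hpair
    omega
  have hdis : #{a | f' a ≠ g a} < #{a | f a ≠ g a} := by
    refine card_lt_card ((Finset.ssubset_iff_of_subset ?_).2 ⟨v, ?_, ?_⟩)
    · intro a
      by_cases h₁ : a = v
      · subst h₁; simp [hf'v]
      · by_cases h₂ : a = n
        · subst h₂
          simpa [hn] using fun _ => g.valid hvn
        · simp [hf'o a h₁ h₂]
    · simpa [hv] using hgv.symm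
    · simp [hf'v]
  refine hfmin f' hf' (Prod.Lex.toLex_lt_toLex.2 (Or.inr ⟨hfiber, ?_⟩))
  rcases hconf.lt_or_eq with h | h
  · exact Prod.Lex.toLex_lt_toLex.2 (Or.inl h)
  · exact Prod.Lex.toLex_lt_toLex.2 (Or.inr ⟨h, hdis⟩)

end Recoloring

section ChromNum

variable {V : Type*}

theorem colorable_chromNum [Finite V] (G : SimpleGraph V) : G.Colorable (chromNum G) := by
  have := Fintype.ofFinite V
  exact Nat.sInf_mem (s := {n : ℕ | G.Colorable n}) ⟨_, G.colorable_of_fintype⟩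

theorem chromNum_le {G : SimpleGraph V} {n : ℕ} (h : G.Colorable n) : chromNum G ≤ n :=
  Nat.sInf_le h

/-- A colouring of `G - S`, extended by the new colour `none` on `S`. -/
noncomputable def extendColoring {β : Type*} {G : SimpleGraph V} {S : Set V}
    (c : (G.induce Sᶜ).Coloring β) (v : V) : Option β :=
  open Classical in if h : v ∈ S then none else some (c ⟨v, h⟩)

theorem extendColoring_eq_none {β : Type*} {G : SimpleGraph V} {S : Set V}
    (c : (G.induce Sᶜ).Coloring β) (v : V) : extendColoring c v = none ↔ v ∈ S := by
  unfold extendColoring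
  split_ifs with h <;> simp [h]

theorem properOff_extendColoring {β : Type*} {G : SimpleGraph V} {S : Set V}
    (c : (G.induce Sᶜ).Coloring β) : ProperOff G none (extendColoring c) := by
  intro x y hxy he
  unfold extendColoring at he ⊢
  split_ifs at he ⊢ with hx hy
  · rfl
  · exact absurd (Option.some_injective _ he) (c.valid (by simpa using hxy))

/-- Deleting an independent set lowers the chromatic number by at most one. -/
theorem chromNum_le_chromNum_induce_compl_add_one [Finite V] {G : SimpleGraph V} {S : Set V}
    (hS : ∀ u ∈ S, ∀ v ∈ S, ¬ G.Adj u v) :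
    chromNum G ≤ chromNum (G.induce Sᶜ) + 1 := by
  obtain ⟨c⟩ := colorable_chromNum (G.induce Sᶜ)
  let c' : G.Coloring (Option (Fin (chromNum (G.induce Sᶜ)))) :=
    Coloring.mk (extendColoring c) fun {x y} hxy he => by
      have hx := properOff_extendColoring c hxy he
      exact hS x ((extendColoring_eq_none c x).1 hx) y
        ((extendColoring_eq_none c y).1 (he ▸ hx)) hxy
  exact chromNum_le (by simpa using c'.colorable)

/-- Deleting the colour class of `none` leaves a graph coloured by the remaining colours. -/
theorem colorable_induce_compl_of_coloring_option {G : SimpleGraph V} {n : ℕ}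
    (c : G.Coloring (Option (Fin n))) {S : Set V} (hS : ∀ v, c v = none → v ∈ S) :
    (G.induce Sᶜ).Colorable n := by
  have hsome (v : (Sᶜ : Set V)) : (c v).isSome :=
    Option.isSome_iff_ne_none.2 fun h => v.2 (hS v h)
  refine ⟨Coloring.mk (fun v => (c v).get (hsome v)) fun {x y} hxy he => ?_⟩
  exact c.valid (by simpa using hxy) (Option.get_inj.1 he)

end ChromNum

/-- If $G$ is a finite simple graph with at least one edge and
$χ(G) = Δ(G)$, then $vs_χ(G) = ivs_χ(G)$. -/
theorem stmt_1 {V : Type*} [Fintype V] (G : SimpleGraph V)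
    (hedge : G.edgeSet.Nonempty)
    (hchi : chromNum G = maxDeg G) :
    vsChi G = ivsChi G := by
  classical
  have hdeg (v : V) : G.degree v ≤ maxDeg G := by
    have h := Finset.le_sup (f := fun v => Nat.card (G.neighborSet v)) (mem_univ v)
    rwa [Nat.card_eq_fintype_card, G.card_neighborSet_eq_degree] at h
  have hpos : 0 < chromNum G := by
    obtain ⟨⟨a, b⟩, hab⟩ := hedge
    rw [hchi]
    exact ((G.degree_pos_iff_exists_adj a).2 ⟨b, hab⟩).trans_le (hdeg a)
  obtain ⟨n, hn⟩ : ∃ n, chromNum G = n + 1 := ⟨chromNum G - 1, by omega⟩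
  obtain ⟨g⟩ : Nonempty (G.Coloring (Option (Fin n))) :=
    ⟨(hn ▸ colorable_chromNum G : G.Colorable (n + 1)).toColoring (by simp)⟩
  -- every deletion set is matched by an independent one that is not larger
  have hind (S : Finset V) (hS : chromNum (G.induce ((S : Set V))ᶜ) = chromNum G - 1) :
      ∃ I : Finset V, #I ≤ #S ∧ (∀ u ∈ I, ∀ v ∈ I, ¬ G.Adj u v) ∧
        chromNum (G.induce ((I : Set V))ᶜ) = chromNum G - 1 := by
    have hcol := colorable_chromNum (G.induce ((S : Set V))ᶜ)
    rw [hS, hn, Nat.add_sub_cancel] at hcol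
    obtain ⟨c₀⟩ := hcol
    obtain ⟨c, hc⟩ := exists_coloring_card_fiber_le G none g
      (fun v => by simpa [← hn, hchi] using hdeg v) (properOff_extendColoring c₀)
    have hI : ∀ u ∈ ({v | c v = none} : Finset V), ∀ v ∈ ({v | c v = none} : Finset V),
        ¬ G.Adj u v := by
      intro u hu v hv huv
      simp only [mem_filter, mem_univ, true_and] at hu hv
      exact c.valid huv (hu.trans hv.symm)
    refine ⟨({v | c v = none} : Finset V), by simpa [extendColoring_eq_none] using hc, hI, ?_⟩
    have h₁ := chromNum_le (colorable_induce_compl_of_coloring_option c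
      (S := (({v | c v = none} : Finset V) : Set V)) (by simp))
    have h₂ := chromNum_le_chromNum_induce_compl_add_one
      (S := (({v | c v = none} : Finset V) : Set V)) hI
    omega
  unfold vsChi ivsChi
  set A := {k : ℕ | ∃ S : Finset V, S.card = k ∧
    chromNum (G.induce ((S : Set V))ᶜ) = chromNum G - 1}
  set B := {k : ℕ | ∃ S : Finset V, S.card = k ∧ (∀ u ∈ S, ∀ v ∈ S, ¬ G.Adj u v) ∧
    chromNum (G.induce ((S : Set V))ᶜ) = chromNum G - 1}
  have hBA : B ⊆ A := fun k ⟨S, hk, _, hS⟩ => ⟨S, hk, hS⟩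
  rcases A.eq_empty_or_nonempty with hA | hA
  · rw [hA, Set.subset_eq_empty hBA hA]
  · obtain ⟨S, hk, hS⟩ := Nat.sInf_mem hA
    obtain ⟨I, hIS, hI⟩ := hind S hS
    have hIB : #I ∈ B := ⟨I, rfl, hI⟩
    exact le_antisymm (Nat.sInf_le (hBA (Nat.sInf_mem ⟨_, hIB⟩)))
      ((Nat.sInf_le hIB).trans (hIS.trans_eq hk))
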